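/- Let 0 ≤ j < n be integers and d ∈ ℕ. The quadrature rule Q_{n,j} is exact on all polynomials of degree at most d (i.e. T_{n,j}[p] = 0 for every polynomial p of degree at most d) if and only if the algebraic order conditions Σ_{r=1}^{ν} b_r(n−j) c_r^k = k! · h^α · R_{α,α,k}(n−j, 0, 1; h^α λ) hold for every k = 0, 1, …, d. -/

import Mathlib

open MeasureTheory Real

/-- Generalized Mittag–Leffler function `e_{α,β}(t; z)`. -/
noncomputable def mlE (α β t z : ℝ) : ℝ :=
  ∑' k : ℕ, (-z) ^ k * t ^ (α * (k : ℝ) + β - 1) / Real.Gamma (α * (k : ℝ) + β)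

/-- The generalized step function `G_{ξ,k}(t) = (t-ξ)_+^k`. -/
noncomputable def stepG (ξ : ℝ) (k : ℕ) (t : ℝ) : ℝ :=
  if ξ ≤ t then (t - ξ) ^ k else 0

/-- The quadrature remainder `T_{n,j}[g] = I_j[g,t_n] - Q_{n,j}[g]` for the mesh
`t_j = t_0 + j h`, nodes `c` and weights `b`. -/
noncomputable def quadT (α lam t0 h : ℝ) {ν : ℕ} (c : Fin ν → ℝ) (b : Fin ν → ℕ → ℝ)
    (n j : ℕ) (g : ℝ → ℝ) : ℝ :=
  (∫ s in (t0 + (j : ℝ) * h)..(t0 + ((j : ℝ) + 1) * h),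
      mlE α α (t0 + (n : ℝ) * h - s) lam * g s)
    - ∑ r, b r (n - j) * g (t0 + (j : ℝ) * h + c r * h)

/-- The weighted integral `R_{α,β,r}(t, a, b; z)`. -/
noncomputable def Rml (α β r t a b z : ℝ) : ℝ :=
  (1 / Real.Gamma (r + 1)) * ∫ s in a..b, mlE α β (t - s) z * (s - a) ^ r

/-- For `x ≥ 1` the Gamma function dominates `x ↦ R ^ (x - 1)` up to a constant. -/
theorem Real.rpow_mul_exp_neg_le_Gamma {R x : ℝ} (hR : 0 < R) (hx : 1 ≤ x) :
    R ^ (x - 1) * Real.exp (-R) ≤ Real.Gamma x := by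
  have hx0 : 0 < x := by linarith
  have hconv := Real.GammaIntegral_convergent hx0
  have hsub : Set.Ioi R ⊆ Set.Ioi (0 : ℝ) := Set.Ioi_subset_Ioi hR.le
  rw [Real.Gamma_eq_integral hx0, ← integral_exp_neg_Ioi R, ← integral_const_mul]
  calc ∫ t in Set.Ioi R, R ^ (x - 1) * Real.exp (-t)
      ≤ ∫ t in Set.Ioi R, Real.exp (-t) * t ^ (x - 1) := by
        refine setIntegral_mono_on ((integrableOn_exp_neg_Ioi R).const_mul _)
          (hconv.mono_set hsub) measurableSet_Ioi fun t ht => ?_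
        rw [mul_comm]
        exact mul_le_mul_of_nonneg_left
          (Real.rpow_le_rpow hR.le (le_of_lt ht) (by linarith)) (Real.exp_pos _).le
    _ ≤ ∫ t in Set.Ioi (0 : ℝ), Real.exp (-t) * t ^ (x - 1) := by
        refine setIntegral_mono_set hconv ?_ hsub.eventuallyLE
        filter_upwards [ae_restrict_mem measurableSet_Ioi] with t ht
        exact mul_nonneg (Real.exp_pos _).le (Real.rpow_nonneg (le_of_lt ht) _)

/-- The series `∑ y ^ k / Γ(α k + β)` converges for every `y ≥ 0`. -/
theorem summable_pow_div_Gamma {α β y : ℝ} (hα : 0 < α) (hy : 0 ≤ y) :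
    Summable fun k : ℕ => y ^ k / Real.Gamma (α * (k : ℝ) + β) := by
  set R : ℝ := (y + 1) ^ α⁻¹ with hRdef
  have hR : 0 < R := Real.rpow_pos_of_pos (by linarith) _
  have hRα : R ^ α = y + 1 := Real.rpow_inv_rpow (by linarith) hα.ne'
  have hgeo : Summable fun k : ℕ => (y / (y + 1)) ^ k * (R ^ (β - 1) * Real.exp (-R))⁻¹ :=
    (summable_geometric_of_lt_one (by positivity)
      ((div_lt_one (by linarith)).2 (by linarith))).mul_right _
  refine hgeo.of_norm_bounded_eventually_nat ?_
  filter_upwards [Filter.eventually_ge_atTop ⌈(1 - β) / α⌉₊] with k hk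
  have hk1 : 1 ≤ α * (k : ℝ) + β := by
    have := (div_le_iff₀ hα).1 (Nat.ceil_le.1 hk)
    linarith
  have hΓ := Real.rpow_mul_exp_neg_le_Gamma hR hk1
  have hpow : R ^ (α * (k : ℝ) + β - 1) = (y + 1) ^ k * R ^ (β - 1) := by
    rw [add_sub_assoc, Real.rpow_add hR, Real.rpow_mul hR.le, hRα, Real.rpow_natCast]
  rw [hpow, mul_assoc] at hΓ
  have hpos : 0 < (y + 1) ^ k * (R ^ (β - 1) * Real.exp (-R)) := by positivity
  rw [Real.norm_of_nonneg (div_nonneg (by positivity) (hpos.le.trans hΓ)), div_pow,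
    ← div_eq_mul_inv, div_div]
  exact div_le_div_of_nonneg_left (by positivity) hpos hΓ

/-- Homogeneity of the Mittag–Leffler function. -/
theorem mlE_mul {α β h u : ℝ} (z : ℝ) (hh : 0 < h) (hu : 0 ≤ u) :
    mlE α β (h * u) z = h ^ (β - 1) * mlE α β u (h ^ α * z) := by
  unfold mlE
  rw [← tsum_mul_left]
  refine tsum_congr fun k => ?_
  rw [Real.mul_rpow hh.le hu, show α * (k : ℝ) + β - 1 = α * k + (β - 1) by ring,
    Real.rpow_add hh, Real.rpow_mul hh.le, Real.rpow_natCast, neg_mul_eq_mul_neg, mul_pow]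
  ring

/-- The kernel `e_{α,α}(·; z)` is integrable on `[0, M]`, despite its singularity at the origin. -/
theorem intervalIntegrable_mlE {α M : ℝ} (z : ℝ) (hα : 0 < α) (hM : 0 ≤ M) :
    IntervalIntegrable (fun t => mlE α α t z) volume 0 M := by
  have hcont : ContinuousOn
      (fun t : ℝ => ∑' k : ℕ, (-z * t ^ α) ^ k / Real.Gamma (α * (k : ℝ) + α))
      (Set.uIcc 0 M) := by
    rw [Set.uIcc_of_le hM]
    refine continuousOn_tsum (fun k => ?_)
      (summable_pow_div_Gamma (β := α) hα (by positivity : 0 ≤ |z| * M ^ α)) fun k t ht => ?_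
    · have := Real.continuous_rpow_const hα.le
      fun_prop
    · have hΓ : 0 < Real.Gamma (α * (k : ℝ) + α) := Real.Gamma_pos_of_pos (by positivity)
      rw [norm_div, Real.norm_of_nonneg hΓ.le, norm_pow, norm_mul, norm_neg, Real.norm_eq_abs,
        Real.norm_of_nonneg (Real.rpow_nonneg ht.1 _)]
      have := Real.rpow_le_rpow ht.1 ht.2 hα.le
      have := Real.rpow_nonneg ht.1 α
      gcongr
  have hint := (intervalIntegral.intervalIntegrable_rpow' (a := 0) (b := M)
    (by linarith : -1 < α - 1)).mul_continuousOn hcont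
  refine hint.congr fun t ht => ?_
  rw [Set.uIoc_of_le hM] at ht
  simp only [mlE]
  rw [← tsum_mul_left]
  refine tsum_congr fun k => ?_
  rw [show α * (k : ℝ) + α - 1 = α * k + (α - 1) by ring, Real.rpow_add ht.1,
    Real.rpow_mul ht.1.le, Real.rpow_natCast, mul_pow]
  ring

/-- The quadrature remainder rescaled to the unit interval. -/
theorem quadT_eq_unitInterval (α lam t0 : ℝ) {h : ℝ} (hh : 0 < h) {ν : ℕ}
    (c : Fin ν → ℝ) (b : Fin ν → ℕ → ℝ) {n j : ℕ} (hjn : j < n) (g : ℝ → ℝ) :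
    quadT α lam t0 h c b n j g =
      h ^ α * (∫ u in (0 : ℝ)..1,
          mlE α α ((n : ℝ) - (j : ℝ) - u) (h ^ α * lam) * g (t0 + (j : ℝ) * h + h * u))
        - ∑ r, b r (n - j) * g (t0 + (j : ℝ) * h + h * c r) := by
  have hjn' : (j : ℝ) + 1 ≤ n := by exact_mod_cast hjn
  have hsubst := intervalIntegral.smul_integral_comp_add_mul (a := 0) (b := 1)
    (fun s => mlE α α (t0 + (n : ℝ) * h - s) lam * g s) h (t0 + (j : ℝ) * h)
  rw [quadT, show t0 + (j : ℝ) * h = t0 + (j : ℝ) * h + h * 0 by ring,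
    show t0 + ((j : ℝ) + 1) * h = t0 + (j : ℝ) * h + h * 1 by ring, ← hsubst]
  congr 1
  · have hker : ∀ u ∈ Set.uIcc (0 : ℝ) 1,
        mlE α α (t0 + (n : ℝ) * h - (t0 + (j : ℝ) * h + h * u)) lam
            * g (t0 + (j : ℝ) * h + h * u)
          = h ^ (α - 1) * (mlE α α ((n : ℝ) - (j : ℝ) - u) (h ^ α * lam)
            * g (t0 + (j : ℝ) * h + h * u)) := fun u hu => by
      rw [Set.uIcc_of_le zero_le_one] at hu
      rw [show t0 + (n : ℝ) * h - (t0 + (j : ℝ) * h + h * u) = h * ((n : ℝ) - j - u) by ring,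
        mlE_mul lam hh (by linarith [hu.2]), mul_assoc]
    rw [intervalIntegral.integral_congr hker, intervalIntegral.integral_const_mul, smul_eq_mul,
      ← mul_assoc, mul_comm h, ← Real.rpow_add_one hh.ne', sub_add_cancel]
    simp only [mul_zero, add_zero]
  · simp only [mul_zero, add_zero, mul_comm]

/-- The moment of order `k` of the kernel on the unit interval. -/
theorem factorial_mul_Rml (α β N z : ℝ) (k : ℕ) :
    (k.factorial : ℝ) * Rml α β k N 0 1 z = ∫ u in (0 : ℝ)..1, mlE α β (N - u) z * u ^ k := by
  rw [Rml, Real.Gamma_nat_eq_factorial, ← mul_assoc, mul_one_div_cancel (by positivity), one_mul]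
  simp only [sub_zero, Real.rpow_natCast]

theorem degree_of_precision_iff_order_conditions (α lam t0 h : ℝ)
    (hα : 0 < α) (hh : 0 < h) (ν : ℕ)
    (c : Fin ν → ℝ) (hc : ∀ r, c r ∈ Set.Icc (0 : ℝ) 1) (b : Fin ν → ℕ → ℝ)
    (n j d : ℕ) (hjn : j < n) :
    (∀ p : Polynomial ℝ, p.natDegree ≤ d →
        quadT α lam t0 h c b n j (fun x => p.eval x) = 0) ↔
      (∀ k ≤ d,
        ∑ r, b r (n - j) * c r ^ k
          = (k.factorial : ℝ) * h ^ α
              * Rml α α k ((n : ℝ) - (j : ℝ)) 0 1 (h ^ α * lam)) := by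
  have hjn' : (j : ℝ) + 1 ≤ n := by exact_mod_cast hjn
  have hmoment : ∀ k : ℕ, (k.factorial : ℝ) * h ^ α
      * Rml α α k ((n : ℝ) - (j : ℝ)) 0 1 (h ^ α * lam) = h ^ α * ∫ u in (0 : ℝ)..1,
        mlE α α ((n : ℝ) - (j : ℝ) - u) (h ^ α * lam) * u ^ k := fun k => by
    rw [← factorial_mul_Rml]
    ring
  simp only [hmoment]
  constructor
  · intro H k hk
    have hp := H (((Polynomial.X - Polynomial.C (t0 + (j : ℝ) * h)) * Polynomial.C h⁻¹) ^ k) (by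
      refine Polynomial.natDegree_pow_le_of_le k
        ((Polynomial.natDegree_mul_C_le _ _).trans (Polynomial.natDegree_X_sub_C_le _)) |>.trans ?_
      simpa using hk)
    rw [quadT_eq_unitInterval α lam t0 hh c b hjn] at hp
    simp only [Polynomial.eval_pow, Polynomial.eval_mul, Polynomial.eval_sub, Polynomial.eval_X,
      Polynomial.eval_C, add_sub_cancel_left, mul_right_comm h _ h⁻¹,
      mul_inv_cancel₀ hh.ne', one_mul] at hp
    linarith
  · intro H p hp
    set q := p.comp (Polynomial.C (t0 + (j : ℝ) * h) + Polynomial.C h * Polynomial.X) with hq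
    have hqd : q.natDegree < d + 1 := by
      refine Nat.lt_succ_of_le (Polynomial.natDegree_comp_le.trans ?_)
      have hlin : (Polynomial.C (t0 + (j : ℝ) * h)
          + Polynomial.C h * Polynomial.X).natDegree ≤ 1 := by
        compute_degree
      exact (Nat.mul_le_mul hp hlin).trans (mul_one d).le
    have heval : ∀ u : ℝ, p.eval (t0 + (j : ℝ) * h + h * u)
        = ∑ k ∈ Finset.range (d + 1), q.coeff k * u ^ k := fun u => by
      rw [← Polynomial.eval_eq_sum_range' hqd, hq]
      simp
    have hw : IntervalIntegrable
        (fun u => mlE α α ((n : ℝ) - (j : ℝ) - u) (h ^ α * lam)) volume 0 1 := by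
      have hM : (0 : ℝ) ≤ (n : ℝ) - j := by linarith
      have hfull := (intervalIntegrable_mlE (h ^ α * lam) hα hM).comp_sub_left ((n : ℝ) - j)
      rw [sub_zero, sub_self] at hfull
      refine hfull.symm.mono_set ?_
      rw [Set.uIcc_of_le zero_le_one, Set.uIcc_of_le hM]
      exact Set.Icc_subset_Icc_right (by linarith)
    rw [quadT_eq_unitInterval α lam t0 hh c b hjn, sub_eq_zero]
    simp only [heval, Finset.mul_sum, mul_left_comm _ (q.coeff _)]
    rw [intervalIntegral.integral_finsetSum fun k _ =>
      (hw.mul_continuousOn (continuous_pow k).continuousOn).const_mul _, Finset.mul_sum,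
      Finset.sum_comm]
    refine Finset.sum_congr rfl fun k hk => ?_
    rw [intervalIntegral.integral_const_mul, mul_left_comm, ← Finset.mul_sum,
      H k (Nat.lt_succ_iff.1 (Finset.mem_range.1 hk))]
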